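/- arXiv:1609.08357 — 6 statements merged into one kernel-verified Lean document; each statement's English description precedes it below -/
import Mathlib

section
/- Let ξ : [0,T] → ℝ be continuous and let x, y : [0,T] → ℝ satisfy x(0) = y(0) = 0, with t ↦ x(t) − ξ(t) nondecreasing and t ↦ y(t) + ξ(t) nondecreasing. Suppose ε ≥ 0 is such that |x(t) − y(t)| ≤ ε for all t ∈ [0,T]. Then for every partition 0 = t₀ ≤ t₁ ≤ … ≤ t_n = T of [0,T] and every index i ∈ {0,…,n}, one has min{x(t_i), y(t_i)} ≥ Σ_{j=0}^{i−1} |ξ(t_{j+1}) − ξ(t_j)| − i·ε. -/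
/-- Key induction step: if `x - ξ` and `y + ξ` are nondecreasing on `[0,T]`,
`x 0 = y 0 = 0`, and `|x - y| ≤ ε` on `[0,T]`, then along any partition
`0 = t 0 ≤ t 1 ≤ … ≤ t n = T` one has, for every `i ≤ n`,
`min (x (t i)) (y (t i)) ≥ ∑_{j<i} |ξ (t (j+1)) - ξ (t j)| - i·ε`. -/
theorem stmt0 (T : ℝ) (hT : 0 < T) (ξ x y : ℝ → ℝ)
    (hξcont : ContinuousOn ξ (Set.Icc 0 T))
    (hx0 : x 0 = 0) (hy0 : y 0 = 0)
    (hxmono : MonotoneOn (fun t => x t - ξ t) (Set.Icc 0 T))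
    (hymono : MonotoneOn (fun t => y t + ξ t) (Set.Icc 0 T))
    (ε : ℝ) (hε : 0 ≤ ε)
    (hclose : ∀ t ∈ Set.Icc (0 : ℝ) T, |x t - y t| ≤ ε)
    (n : ℕ) (t : ℕ → ℝ) (ht0 : t 0 = 0) (htn : t n = T)
    (htmono : ∀ i < n, t i ≤ t (i + 1)) :
    ∀ i ≤ n, min (x (t i)) (y (t i)) ≥
      (∑ j ∈ Finset.range i, |ξ (t (j + 1)) - ξ (t j)|) - (i : ℝ) * ε := by
  have hmono : Monotone fun i => t (min i n) := monotone_nat_of_le_succ fun i => by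
    rcases lt_or_ge i n with h | h
    · simpa [min_eq_left h.le, min_eq_left (Nat.succ_le_of_lt h)] using htmono i h
    · simp [min_eq_right h, min_eq_right (h.trans i.le_succ)]
  have hmem : ∀ i ≤ n, t i ∈ Set.Icc 0 T := fun i hi => by
    have h0 := hmono i.zero_le
    have h1 := hmono hi
    simp only [Nat.zero_min, min_eq_left hi, min_self, ht0, htn] at h0 h1
    exact ⟨h0, h1⟩
  intro i
  induction i with
  | zero => simp [ht0, hx0, hy0]
  | succ i ih =>
    intro hi
    obtain ⟨ihx, ihy⟩ := le_min_iff.mp (ih (Nat.le_of_succ_le hi))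
    have hti := hmem i (Nat.le_of_succ_le hi)
    have hti' := hmem (i + 1) hi
    have hx := hxmono hti hti' (htmono i hi)
    have hy := hymono hti hti' (htmono i hi)
    obtain ⟨hl, hr⟩ := abs_le.mp (hclose _ hti')
    simp only at hx hy
    rw [Finset.sum_range_succ, ge_iff_le, le_min_iff]
    push_cast
    rcases abs_cases (ξ (t (i + 1)) - ξ (t i)) with ⟨h, _⟩ | ⟨h, _⟩ <;>
      rw [h] <;> constructor <;> linarith
end

section
/- Let ξ : [0,T] → ℝ be continuous and let x, y : [0,T] → ℝ satisfy x(0) = y(0) = 0, with t ↦ x(t) − ξ(t) nondecreasing and t ↦ y(t) + ξ(t) nondecreasing. Suppose ε ≥ 0 is such that |x(t) − y(t)| ≤ ε for all t ∈ [0,T]. Then for every partition 0 = t₀ ≤ t₁ ≤ … ≤ t_n = T of [0,T], one has min{x(T), y(T)} ≥ Σ_{j=0}^{n−1} |ξ(t_{j+1}) − ξ(t_j)| − n·ε. -/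
/-- Over one step, the smaller of `x` and `y` grows by at least the increment of `ξ`, up to `ε`. -/
theorem min_add_abs_sub_sub_le {a b a' b' p q ε : ℝ}
    (ha : a - p ≤ a' - q) (hb : b + p ≤ b' + q) (h : |a' - b'| ≤ ε) :
    min a b + |q - p| - ε ≤ min a' b' := by
  obtain ⟨h₁, h₂⟩ := abs_le.mp h
  have hma := min_le_left a b
  have hmb := min_le_right a b
  rcases abs_cases (q - p) with ⟨hq, _⟩ | ⟨hq, _⟩ <;> rw [hq] <;>
    apply le_min <;> linarith

/-- A finite sequence that is nondecreasing step by step is nondecreasing. -/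
theorem le_of_forall_lt_le_succ {t : ℕ → ℝ} {n : ℕ} (ht : ∀ i < n, t i ≤ t (i + 1))
    {i j : ℕ} (hij : i ≤ j) (hj : j ≤ n) : t i ≤ t j := by
  induction j, hij using Nat.le_induction with
  | base => exact le_rfl
  | succ k _ ih => exact (ih (by omega)).trans (ht k (by omega))

/-- Terminal-time form of the induction estimate: under the same hypotheses,
`min (x T) (y T) ≥ ∑_{j<n} |ξ (t (j+1)) - ξ (t j)| - n·ε` for every partition. -/
theorem stmt1 (T : ℝ) (hT : 0 < T) (ξ x y : ℝ → ℝ)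
    (hξcont : ContinuousOn ξ (Set.Icc 0 T))
    (hx0 : x 0 = 0) (hy0 : y 0 = 0)
    (hxmono : MonotoneOn (fun t => x t - ξ t) (Set.Icc 0 T))
    (hymono : MonotoneOn (fun t => y t + ξ t) (Set.Icc 0 T))
    (ε : ℝ) (hε : 0 ≤ ε)
    (hclose : ∀ t ∈ Set.Icc (0 : ℝ) T, |x t - y t| ≤ ε)
    (n : ℕ) (t : ℕ → ℝ) (ht0 : t 0 = 0) (htn : t n = T)
    (htmono : ∀ i < n, t i ≤ t (i + 1)) :
    min (x T) (y T) ≥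
      (∑ j ∈ Finset.range n, |ξ (t (j + 1)) - ξ (t j)|) - (n : ℝ) * ε := by
  have hmem : ∀ k ≤ n, t k ∈ Set.Icc 0 T := fun k hk =>
    ⟨ht0 ▸ le_of_forall_lt_le_succ htmono (Nat.zero_le k) hk,
      htn ▸ le_of_forall_lt_le_succ htmono hk le_rfl⟩
  have key : ∀ k ≤ n, (∑ j ∈ Finset.range k, |ξ (t (j + 1)) - ξ (t j)|) - (k : ℝ) * ε ≤
      min (x (t k)) (y (t k)) := by
    intro k
    induction k with
    | zero => simp [ht0, hx0, hy0]
    | succ k ih =>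
      intro hk
      have hs := hmem k (by omega)
      have hu := hmem (k + 1) hk
      have hsu := htmono k hk
      have hstep := min_add_abs_sub_sub_le (hxmono hs hu hsu) (hymono hs hu hsu) (hclose _ hu)
      rw [Finset.sum_range_succ]
      push_cast
      linarith [ih (by omega)]
  simpa only [htn] using key n le_rfl
end

section
/- Let ξ : [0,T] → ℝ be continuous, R ∈ ℝ, and let x, y : [0,T] → ℝ satisfy x(0) = y(0) = 0, with t ↦ x(t) − ξ(t) nondecreasing and t ↦ y(t) + ξ(t) nondecreasing. Suppose ε ≥ 0 is such that |x(t) − y(t)| ≤ ε for all t ∈ [0,T], and that min{x(T), y(T)} ≤ R. Then for every partition 0 = t₀ ≤ t₁ ≤ … ≤ t_n = T of [0,T] with n ≥ 1, one has ε ≥ (1/n)·(Σ_{j=0}^{n−1} |ξ(t_{j+1}) − ξ(t_j)| − R). -/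
/-- One step of the estimate: if `x` grows by at least `d`, `y` by at least `-d`, and the
endpoints stay within `ε`, then `min x y` grows by at least `|d| - ε`. -/
lemma min_add_abs_sub_le_min {x₀ y₀ x₁ y₁ d ε : ℝ} (hx : x₀ + d ≤ x₁) (hy : y₀ - d ≤ y₁)
    (h : |x₁ - y₁| ≤ ε) : min x₀ y₀ + |d| - ε ≤ min x₁ y₁ := by
  have hε := (abs_nonneg _).trans h
  have hx₀ := min_le_left x₀ y₀
  have hy₀ := min_le_right x₀ y₀
  obtain ⟨h₁, h₂⟩ := abs_le.mp h
  rcases abs_cases d with ⟨hd, _⟩ | ⟨hd, _⟩ <;> rw [hd] <;>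
    exact le_min (by linarith) (by linarith)

/-- Central quantitative estimate: if moreover `min (x T) (y T) ≤ R`, then for
every partition with `n ≥ 1` intervals,
`ε ≥ (1/n)·(∑_{j<n} |ξ (t (j+1)) - ξ (t j)| - R)`. -/
theorem stmt2 (T : ℝ) (hT : 0 < T) (ξ x y : ℝ → ℝ) (R : ℝ)
    (hξcont : ContinuousOn ξ (Set.Icc 0 T))
    (hx0 : x 0 = 0) (hy0 : y 0 = 0)
    (hxmono : MonotoneOn (fun t => x t - ξ t) (Set.Icc 0 T))
    (hymono : MonotoneOn (fun t => y t + ξ t) (Set.Icc 0 T))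
    (ε : ℝ) (hε : 0 ≤ ε)
    (hclose : ∀ t ∈ Set.Icc (0 : ℝ) T, |x t - y t| ≤ ε)
    (hR : min (x T) (y T) ≤ R)
    (n : ℕ) (hn : 1 ≤ n) (t : ℕ → ℝ) (ht0 : t 0 = 0) (htn : t n = T)
    (htmono : ∀ i < n, t i ≤ t (i + 1)) :
    ε ≥ (1 / (n : ℝ)) *
      ((∑ j ∈ Finset.range n, |ξ (t (j + 1)) - ξ (t j)|) - R) := by
  have hmono : MonotoneOn t (Set.Iic n) := by
    refine monotoneOn_of_le_add_one Set.ordConnected_Iic fun i _ _ hi => ?_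
    exact htmono i hi
  have hmem : ∀ k ≤ n, t k ∈ Set.Icc (0 : ℝ) T := fun k hk =>
    ⟨ht0 ▸ hmono (Nat.zero_le n) hk (Nat.zero_le k), htn ▸ hmono hk Set.self_mem_Iic hk⟩
  have hsum : ∀ k ≤ n, (∑ j ∈ Finset.range k, |ξ (t (j + 1)) - ξ (t j)|) - k * ε ≤
      min (x (t k)) (y (t k)) := by
    intro k
    induction k with
    | zero => simp [ht0, hx0, hy0]
    | succ k ih =>
      intro hk
      have hk₀ := hmem k (by lia)
      have hk₁ := hmem (k + 1) hk
      have hx := hxmono hk₀ hk₁ (htmono k hk)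
      have hy := hymono hk₀ hk₁ (htmono k hk)
      have hstep := min_add_abs_sub_le_min (x₀ := x (t k)) (y₀ := y (t k))
        (d := ξ (t (k + 1)) - ξ (t k))
        (by linarith) (by linarith) (hclose _ hk₁)
      rw [Finset.sum_range_succ]
      push_cast
      linarith [ih (by lia)]
  have hfinal := hsum n le_rfl
  rw [htn] at hfinal
  have hnpos : (0 : ℝ) < n := by exact_mod_cast hn
  rw [ge_iff_le, one_div, inv_mul_le_iff₀ hnpos]
  linarith
end

section
/- Let ξ : [0,T] → ℝ be continuous with total variation V_{0,T}(ξ) := sup over partitions 0 = t₀ ≤ … ≤ t_n = T of Σ_{j=0}^{n−1} |ξ(t_{j+1}) − ξ(t_j)| satisfying V_{0,T}(ξ) > R for some R ∈ ℝ. Let x, y : [0,T] → ℝ satisfy x(0) = y(0) = 0, with t ↦ x(t) − ξ(t) nondecreasing and t ↦ y(t) + ξ(t) nondecreasing, and min{x(T), y(T)} ≤ R. Then sup_{t ∈ [0,T]} |x(t) − y(t)| > 0; more precisely, sup_{t ∈ [0,T]} |x(t) − y(t)| ≥ sup over partitions (with n ≥ 1 intervals) of (1/n)·(Σ_{j=0}^{n−1}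 |ξ(t_{j+1}) − ξ(t_j)| − R). -/
/-- Along a sequence on which `u` gains at least `d j` and `v` at least `-d j` at step `j`, while
`|u - v| ≤ ε`, the minimum of `u` and `v` gains at least `|d j| - ε` at each step. -/
theorem sum_abs_sub_mul_le_min {u v d : ℕ → ℝ} {ε : ℝ} {n : ℕ}
    (hu : ∀ j < n, u j + d j ≤ u (j + 1)) (hv : ∀ j < n, v j - d j ≤ v (j + 1))
    (huv : ∀ j ≤ n, |u j - v j| ≤ ε) :
    min (u 0) (v 0) + (∑ j ∈ Finset.range n, |d j|) - n * ε ≤ min (u n) (v n) := by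
  induction n with
  | zero => simp
  | succ n ih =>
    have ih := ih (fun j hj => hu j (by omega)) (fun j hj => hv j (by omega))
      (fun j hj => huv j (by omega))
    have hun := hu n (by omega)
    have hvn := hv n (by omega)
    obtain ⟨hlow, hupp⟩ := abs_le.mp (huv (n + 1) le_rfl)
    have hminu := min_le_left (u n) (v n)
    have hminv := min_le_right (u n) (v n)
    have hε : 0 ≤ ε := (abs_nonneg _).trans (huv (n + 1) le_rfl)
    rw [Finset.sum_range_succ]
    push_cast
    rcases abs_cases (d n) with ⟨h, -⟩ | ⟨h, -⟩ <;> rw [h] <;> apply le_min <;> linarith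

/-- A function which becomes monotone on a compact interval after adding a continuous function is
bounded in absolute value on that interval. -/
theorem exists_abs_le_of_monotoneOn_add {f g : ℝ → ℝ} {a b : ℝ}
    (hg : ContinuousOn g (Set.Icc a b)) (hfg : MonotoneOn (fun t => f t + g t) (Set.Icc a b)) :
    ∃ C, ∀ t ∈ Set.Icc a b, |f t| ≤ C := by
  obtain ⟨C, hC⟩ := isCompact_Icc.exists_bound_of_continuousOn hg
  refine ⟨|f a + g a| + |f b + g b| + C, fun t ht => ?_⟩
  have hab : a ≤ b := ht.1.trans ht.2
  have hgt := abs_le.mp (hC t ht)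
  have hlow : f a + g a ≤ f t + g t := hfg (Set.left_mem_Icc.mpr hab) ht ht.1
  have hupp : f t + g t ≤ f b + g b := hfg ht (Set.right_mem_Icc.mpr hab) ht.2
  have := neg_abs_le (f a + g a)
  have := le_abs_self (f b + g b)
  have := abs_nonneg (f a + g a)
  have := abs_nonneg (f b + g b)
  rw [abs_le]
  constructor <;> linarith

/-- Trajectory-level content of the main theorem: if the total variation of ξ on
`[0,T]` exceeds `R` (i.e. some partition has oscillation sum `> R`), `x - ξ` and
`y + ξ` are nondecreasing, `x 0 = y 0 = 0` and `min (x T) (y T) ≤ R`, then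
`sup_{t ∈ [0,T]} |x t - y t| > 0`; more precisely this supremum dominates
`(1/n)·(∑_{j<n} |ξ (t (j+1)) - ξ (t j)| - R)` for every partition with `n ≥ 1`
intervals. -/
theorem stmt3 (T : ℝ) (hT : 0 < T) (ξ x y : ℝ → ℝ) (R : ℝ)
    (hξcont : ContinuousOn ξ (Set.Icc 0 T))
    (hvar : ∃ (n : ℕ) (t : ℕ → ℝ), t 0 = 0 ∧ t n = T ∧
      (∀ i < n, t i ≤ t (i + 1)) ∧
      R < ∑ j ∈ Finset.range n, |ξ (t (j + 1)) - ξ (t j)|)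
    (hx0 : x 0 = 0) (hy0 : y 0 = 0)
    (hxmono : MonotoneOn (fun t => x t - ξ t) (Set.Icc 0 T))
    (hymono : MonotoneOn (fun t => y t + ξ t) (Set.Icc 0 T))
    (hR : min (x T) (y T) ≤ R) :
    0 < sSup ((fun t => |x t - y t|) '' Set.Icc 0 T) ∧
    ∀ (n : ℕ), 1 ≤ n → ∀ t : ℕ → ℝ, t 0 = 0 → t n = T →
      (∀ i < n, t i ≤ t (i + 1)) →
      sSup ((fun t => |x t - y t|) '' Set.Icc 0 T) ≥
        (1 / (n : ℝ)) *
          ((∑ j ∈ Finset.range n, |ξ (t (j + 1)) - ξ (t j)|) - R) := by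
  have hbdd : BddAbove ((fun t => |x t - y t|) '' Set.Icc 0 T) := by
    obtain ⟨C, hC⟩ := exists_abs_le_of_monotoneOn_add hξcont.neg
      (f := x) (by simpa [sub_eq_add_neg] using hxmono)
    obtain ⟨D, hD⟩ := exists_abs_le_of_monotoneOn_add hξcont hymono
    refine ⟨C + D, ?_⟩
    rintro _ ⟨t, ht, rfl⟩
    exact (abs_sub _ _).trans (add_le_add (hC t ht) (hD t ht))
  set ε := sSup ((fun t => |x t - y t|) '' Set.Icc 0 T)
  have hbound : ∀ (n : ℕ) (t : ℕ → ℝ), t 0 = 0 → t n = T → (∀ i < n, t i ≤ t (i + 1)) →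
      (∑ j ∈ Finset.range n, |ξ (t (j + 1)) - ξ (t j)|) - R ≤ n * ε := by
    intro n t ht0 htn hstep
    have hmono : MonotoneOn t (Set.Iic n) :=
      monotoneOn_of_le_succ Set.ordConnected_Iic fun i _ _ hi => hstep i hi
    have hmem : ∀ j ≤ n, t j ∈ Set.Icc 0 T := fun j hj =>
      ⟨ht0 ▸ hmono (Nat.zero_le n) hj (Nat.zero_le j), htn ▸ hmono hj (le_refl n) hj⟩
    have key := sum_abs_sub_mul_le_min (u := fun j => x (t j)) (v := fun j => y (t j))
      (d := fun j => ξ (t (j + 1)) - ξ (t j)) (ε := ε) (n := n)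
      (fun j hj => by
        have h := hxmono (hmem j hj.le) (hmem (j + 1) hj) (hstep j hj)
        dsimp only at h ⊢
        linarith)
      (fun j hj => by
        have h := hymono (hmem j hj.le) (hmem (j + 1) hj) (hstep j hj)
        dsimp only at h ⊢
        linarith)
      (fun j hj => le_csSup hbdd ⟨t j, hmem j hj, rfl⟩)
    simp only [ht0, htn, hx0, hy0, min_self] at key
    linarith
  refine ⟨?_, fun n hn t ht0 htn hstep => ?_⟩
  · obtain ⟨n, t, ht0, htn, hstep, hlt⟩ := hvar
    have h := hbound n t ht0 htn hstep
    exact pos_of_mul_pos_right (by linarith : 0 < (n : ℝ) * ε) n.cast_nonneg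
  · have hn' : (0 : ℝ) < n := by exact_mod_cast hn
    rw [ge_iff_le, one_div, inv_mul_le_iff₀ hn']
    exact hbound n t ht0 htn hstep
end

section
/- Let T > 0, R > 0, and let ξ : [0,T] → ℝ be continuously differentiable. Let Θ : ℝ² → ℝ be nonnegative with Θ(x,y) ≥ 1 whenever min{x, y} ≥ R. Let 𝒰 be the set of measurable controls β : [0,T] → [−1,1], and let Δ be the set of progressive strategies, i.e. maps δ : 𝒰 → 𝒰 such that whenever β = β' almost everywhere on [0,t], then δ(β)(t) = δ(β')(t). For α, β ∈ 𝒰 define x^{α,β}(T) = ∫₀ᵀ (ξ'₊(s)·α(s) + ξ'₋(s)·β(s)) ds and y^{α,β}(T) = ∫₀ᵀ (ξ'₋(s)·α(s) + ξ'₊(s)·β(s)) ds, where ξ'₊ = max(ξ', 0) and ξ'₋ = max(−ξ', 0), and set J(α,β) = |x^{α,β}(T) − y^{α,β}(T)| + Θ(x^{α,β}(T), y^{α,β}(T)). Then the upper game value v := sup_{δ ∈ Δ} inf_{β ∈ 𝒰} J(δ(β), β) satisfies v ≥ min{ ( sup over partitions 0 = t₀ ≤ … ≤ t_n = T, n ≥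 1, of (1/n)·(Σ_{j=0}^{n−1} |ξ(t_{j+1}) − ξ(t_j)| − R) )₊ , 1 }. -/
open MeasureTheory
open Set Filter Topology

/-- The measurable controls with values in `[-1, 1]`. -/
def unitControls : Set (ℝ → ℝ) :=
  {β | Measurable β ∧ ∀ s, β s ∈ Icc (-1 : ℝ) 1}

theorem one_mem_unitControls : (fun _ => 1 : ℝ → ℝ) ∈ unitControls :=
  ⟨measurable_const, fun _ => by norm_num⟩

theorem locallyIntegrable_of_mem_unitControls {β : ℝ → ℝ} (hβ : β ∈ unitControls) :
    LocallyIntegrable β volume := by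
  refine (locallyIntegrable_const (1 : ℝ)).mono hβ.1.aestronglyMeasurable
    (Eventually.of_forall fun s => ?_)
  rw [Real.norm_eq_abs, norm_one]
  exact abs_le.2 (hβ.2 s)

theorem intervalIntegrable_mul_of_mem_unitControls {g β : ℝ → ℝ} (hg : Continuous g)
    (hβ : β ∈ unitControls) (a b : ℝ) :
    IntervalIntegrable (fun s => g s * β s) volume a b :=
  (intervalIntegrable_iff.2 (((locallyIntegrable_of_mem_unitControls hβ).integrableOn_isCompact
    isCompact_uIcc).mono_set uIoc_subset_uIcc)).continuousOn_mul hg.continuousOn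

/-- A copy of `β`, equal to it almost everywhere on the positive half-line, whose value at `t`
depends only on the almost everywhere class of `β` on `[0, t]`: the left derivative of the
primitive of `β`, truncated to `[-1, 1]`. -/
noncomputable def leftDensity (β : ℝ → ℝ) (t : ℝ) : ℝ :=
  max (-1) (min 1
    (-derivWithin (fun s => ∫ r in (0 : ℝ)..max (-s) 0, β r) (Ici (-t)) (-t)))

theorem leftDensity_mem_unitControls (β : ℝ → ℝ) : leftDensity β ∈ unitControls := by
  refine ⟨?_, fun s => ⟨le_max_left _ _, max_le (by norm_num) (min_le_left _ _)⟩⟩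
  refine measurable_const.max (measurable_const.min ?_)
  exact ((measurable_derivWithin_Ici _).comp measurable_neg).neg

theorem integral_congr_of_ae_eq_restrict {f f' : ℝ → ℝ} {s t : ℝ} (hs : 0 ≤ s) (hst : s ≤ t)
    (h : ∀ᵐ r ∂(volume.restrict (Icc 0 t)), f r = f' r) :
    ∫ r in (0 : ℝ)..s, f r = ∫ r in (0 : ℝ)..s, f' r := by
  refine intervalIntegral.integral_congr_ae ?_
  filter_upwards [(ae_restrict_iff' measurableSet_Icc).1 h] with r hr hmem
  rw [uIoc_of_le hs] at hmem
  exact hr ⟨hmem.1.le, hmem.2.trans hst⟩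

theorem leftDensity_congr {β β' : ℝ → ℝ} {t : ℝ} (ht : 0 ≤ t)
    (h : ∀ᵐ s ∂(volume.restrict (Icc 0 t)), β s = β' s) :
    leftDensity β t = leftDensity β' t := by
  have key : EqOn (fun s => ∫ r in (0 : ℝ)..max (-s) 0, β r)
      (fun s => ∫ r in (0 : ℝ)..max (-s) 0, β' r) (Ici (-t)) := fun s hs =>
    integral_congr_of_ae_eq_restrict (le_max_right _ _)
      (max_le (by linarith [mem_Ici.1 hs]) ht) h
  rw [leftDensity, leftDensity, derivWithin_congr key (key self_mem_Ici)]

theorem leftDensity_ae_eq {β : ℝ → ℝ} (hβ : β ∈ unitControls) :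
    ∀ᵐ t, 0 < t → leftDensity β t = β t := by
  filter_upwards [LocallyIntegrable.ae_hasDerivAt_integral
    (locallyIntegrable_of_mem_unitControls hβ)] with t ht ht0
  have h1 : HasDerivAt (fun s => ∫ r in (0 : ℝ)..max (-s) 0, β r) (-β t) (-t) := by
    have h2 : HasDerivAt (fun s => ∫ r in (0 : ℝ)..(-s), β r) (-β t) (-t) := by
      have h3 := ht 0
      rw [← neg_neg t] at h3
      simpa [Function.comp_def] using h3.comp (-t) (hasDerivAt_neg (-t))
    refine h2.congr_of_eventuallyEq ?_
    filter_upwards [Iio_mem_nhds (show -t < 0 by linarith)] with s hs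
    rw [max_eq_left (by linarith [mem_Iio.1 hs])]
  rw [leftDensity, h1.hasDerivWithinAt.derivWithin (uniqueDiffWithinAt_Ici _), neg_neg,
    min_eq_right (hβ.2 t).2, max_eq_right (hβ.2 t).1]

/-- The gap between the two states at time `s` when the control `1` is played against `β`. -/
noncomputable def gapAgainst (g β : ℝ → ℝ) (s : ℝ) : ℝ :=
  ∫ r in (0 : ℝ)..s, g r * (1 - β r)

open Classical in
/-- The strategy that plays `1` until the gap reaches `L` in absolute value, and copies the
opponent from then on. -/
noncomputable def freezeGap (g : ℝ → ℝ) (L : ℝ) (β : ℝ → ℝ) (t : ℝ) : ℝ :=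
  if ∃ s, 0 ≤ s ∧ s ≤ t ∧ L ≤ |gapAgainst g β s| then leftDensity β t else 1

theorem freezeGap_mem_unitControls (g : ℝ → ℝ) (L : ℝ) (β : ℝ → ℝ) :
    freezeGap g L β ∈ unitControls := by
  refine ⟨?_, fun t => ?_⟩
  · refine Measurable.ite ?_ (leftDensity_mem_unitControls β).1 measurable_const
    refine IsUpperSet.ordConnected (fun t u htu => ?_) |>.measurableSet
    rintro ⟨s, h0, hs, hL⟩
    exact ⟨s, h0, hs.trans htu, hL⟩
  · unfold freezeGap
    split_ifs
    · exact (leftDensity_mem_unitControls β).2 t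
    · norm_num

open Classical in
theorem freezeGap_congr (g : ℝ → ℝ) (L : ℝ) {β β' : ℝ → ℝ} {t : ℝ} (ht : 0 ≤ t)
    (h : ∀ᵐ s ∂(volume.restrict (Icc 0 t)), β s = β' s) :
    freezeGap g L β t = freezeGap g L β' t := by
  have hgap : ∀ s, 0 ≤ s → s ≤ t → gapAgainst g β s = gapAgainst g β' s := fun s h0 hs =>
    integral_congr_of_ae_eq_restrict h0 hs (h.mono fun r hr => by rw [hr])
  have hiff : (∃ s, 0 ≤ s ∧ s ≤ t ∧ L ≤ |gapAgainst g β s|) ↔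
      ∃ s, 0 ≤ s ∧ s ≤ t ∧ L ≤ |gapAgainst g β' s| :=
    exists_congr fun s => and_congr_right fun h0 => and_congr_right fun hs => by
      rw [hgap s h0 hs]
  rw [freezeGap, freezeGap, leftDensity_congr ht h]
  exact if_congr hiff rfl rfl

theorem intervalIntegrable_gap {g β : ℝ → ℝ} (hg : Continuous g) (hβ : β ∈ unitControls)
    (a b : ℝ) : IntervalIntegrable (fun r => g r * (1 - β r)) volume a b := by
  simpa only [mul_sub, mul_one] using
    (hg.intervalIntegrable a b).sub (intervalIntegrable_mul_of_mem_unitControls hg hβ a b)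

/-- Once the gap has reached `L`, the strategy `freezeGap` keeps it there. -/
theorem le_abs_integral_freezeGap {g β : ℝ → ℝ} {L T : ℝ} (hg : Continuous g)
    (hβ : β ∈ unitControls) (h : ∃ s, 0 ≤ s ∧ s ≤ T ∧ L ≤ |gapAgainst g β s|) :
    L ≤ |∫ s in (0 : ℝ)..T, g s * (freezeGap g L β s - β s)| := by
  have hcont : Continuous (gapAgainst g β) :=
    intervalIntegral.continuous_primitive (intervalIntegrable_gap hg hβ) 0
  have hcompact : IsCompact (Icc 0 T ∩ {s | L ≤ |gapAgainst g β s|}) :=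
    isCompact_Icc.inter_right (isClosed_le continuous_const hcont.abs)
  obtain ⟨s, h0, hs, hL⟩ := h
  obtain ⟨τ, ⟨⟨hτ0, hτT⟩, hτL⟩, hmin⟩ := hcompact.exists_isLeast ⟨s, ⟨h0, hs⟩, hL⟩
  have hint : ∀ a b, IntervalIntegrable (fun s => g s * (freezeGap g L β s - β s)) volume a b := by
    intro a b
    simpa only [mul_sub] using (intervalIntegrable_mul_of_mem_unitControls hg
      (freezeGap_mem_unitControls g L β) a b).sub
        (intervalIntegrable_mul_of_mem_unitControls hg hβ a b)
  have hbefore : ∫ s in (0 : ℝ)..τ, g s * (freezeGap g L β s - β s) = gapAgainst g β τ := by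
    refine intervalIntegral.integral_congr_ae ?_
    filter_upwards [compl_mem_ae_iff.2 (measure_singleton τ)] with r hr hmem
    rw [uIoc_of_le hτ0] at hmem
    have hrτ : r < τ := lt_of_le_of_ne hmem.2 hr
    have hone : freezeGap g L β r = 1 := by
      refine if_neg ?_
      rintro ⟨u, hu0, hur, hu⟩
      exact absurd (hmin ⟨⟨hu0, (hur.trans hrτ.le).trans hτT⟩, hu⟩) (by linarith)
    rw [hone]
  have hafter : ∫ s in τ..T, g s * (freezeGap g L β s - β s) = 0 := by
    refine (intervalIntegral.integral_congr_ae ?_).trans intervalIntegral.integral_zero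
    filter_upwards [leftDensity_ae_eq hβ] with r hr hmem
    rw [uIoc_of_le hτT] at hmem
    have hcopy : freezeGap g L β r = leftDensity β r := if_pos ⟨τ, hτ0, hmem.1.le, hτL⟩
    rw [hcopy, hr (hτ0.trans_lt hmem.1), sub_self, mul_zero]
  rw [← intervalIntegral.integral_add_adjacent_intervals (hint 0 τ) (hint τ T), hbefore, hafter,
    add_zero]
  exact hτL

/-- A partial sum of increments of a sequence bounded by `L` and started at `0` grows at most
like `n * L`. -/
theorem sum_increments_le {D : ℕ → ℝ} {L : ℝ} {n : ℕ} (hD0 : D 0 = 0)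
    (hD : ∀ j ≤ n, |D j| ≤ L) (p : ℕ → Prop) [DecidablePred p] :
    ∑ j ∈ Finset.range n, (if p j then D (j + 1) - D j else 0) ≤ n * L := by
  suffices H : ∀ m ≤ n, ∑ j ∈ Finset.range m, (if p j then D (j + 1) - D j else 0) ≤ m * L ∧
      ∑ j ∈ Finset.range m, (if p j then D (j + 1) - D j else 0) - D m ≤ m * L from
    (H n le_rfl).1
  intro m
  induction m with
  | zero => simp [hD0]
  | succ m ih =>
    intro hm
    obtain ⟨h1, h2⟩ := ih (by lia)
    have h3 := abs_le.1 (hD (m + 1) hm)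
    rw [Finset.sum_range_succ]
    push_cast
    split_ifs <;> constructor <;> linarith

/-- If the control `1` keeps the gap below `L` at the nodes of a partition, then the integral of
`max g 0 + max (-g) 0 * β` dominates the variation of the primitive along the partition, up to
`n * L`. -/
theorem variation_sub_le_integral {g β : ℝ → ℝ} {L : ℝ} {n : ℕ} {t : ℕ → ℝ} (hg : Continuous g)
    (hβ : β ∈ unitControls) (ht0 : t 0 = 0) (hmono : ∀ i < n, t i ≤ t (i + 1))
    (hgap : ∀ i ≤ n, |gapAgainst g β (t i)| ≤ L) :
    ∑ j ∈ Finset.range n, |∫ s in t j..t (j + 1), g s| - n * L ≤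
      ∫ s in (0 : ℝ)..t n, (max (g s) 0 * 1 + max (-g s) 0 * β s) := by
  have hint : ∀ a b, IntervalIntegrable (fun s => max (g s) 0 * 1 + max (-g s) 0 * β s)
      volume a b := fun a b =>
    (intervalIntegrable_mul_of_mem_unitControls (hg.max continuous_const)
      one_mem_unitControls a b).add
    (intervalIntegrable_mul_of_mem_unitControls (hg.neg.max continuous_const) hβ a b)
  have hincr : ∀ a b, gapAgainst g β b - gapAgainst g β a = ∫ s in a..b, g s * (1 - β s) :=
    fun a b => intervalIntegral.integral_interval_sub_left
      (intervalIntegrable_gap hg hβ 0 b) (intervalIntegrable_gap hg hβ 0 a)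
  have hsum := sum_increments_le (D := fun j => -gapAgainst g β (t j)) (L := L) (n := n)
    (by simp [ht0, gapAgainst]) (fun j hj => by simpa using hgap j hj)
    (fun j => ¬ 0 ≤ ∫ s in t j..t (j + 1), g s)
  have hadj := intervalIntegral.sum_integral_adjacent_intervals (a := t) (n := n)
    fun k _ => hint _ _
  rw [ht0] at hadj
  rw [← hadj, sub_le_comm, ← Finset.sum_sub_distrib]
  refine (Finset.sum_le_sum fun j hj => ?_).trans hsum
  have hle := hmono j (Finset.mem_range.1 hj)
  have hb := hβ.2
  by_cases hpos : 0 ≤ ∫ s in t j..t (j + 1), g s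
  · rw [if_neg (not_not.2 hpos), abs_of_nonneg hpos, sub_nonpos]
    refine intervalIntegral.integral_mono_on hle (hg.intervalIntegrable _ _) (hint _ _)
      fun s _ => ?_
    obtain ⟨h1, h2⟩ := hb s
    rcases le_total 0 (g s) with h | h
    · rw [max_eq_left h, max_eq_right (by linarith)]; linarith
    · rw [max_eq_right h, max_eq_left (by linarith)]; nlinarith
  · suffices hsub : ∫ s in t j..t (j + 1), (g s * (1 - β s) - g s) ≤
        ∫ s in t j..t (j + 1), (max (g s) 0 * 1 + max (-g s) 0 * β s) by
      rw [intervalIntegral.integral_sub (intervalIntegrable_gap hg hβ _ _)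
        (hg.intervalIntegrable _ _), ← hincr] at hsub
      rw [if_pos hpos, abs_of_neg (not_le.1 hpos)]
      linarith
    refine intervalIntegral.integral_mono_on hle
      ((intervalIntegrable_gap hg hβ _ _).sub (hg.intervalIntegrable _ _)) (hint _ _)
      fun s _ => ?_
    obtain ⟨h1, h2⟩ := hb s
    rcases le_total 0 (g s) with h | h
    · rw [max_eq_left h, max_eq_right (by linarith)]; nlinarith
    · rw [max_eq_right h, max_eq_left (by linarith)]; nlinarith

/-- Either the gap is at least `L`, or both states dominate the variation along the partition
up to `n * L`. -/
theorem freezeGap_dichotomy {g β : ℝ → ℝ} {L T : ℝ} {n : ℕ} {t : ℕ → ℝ} (hg : Continuous g)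
    (hβ : β ∈ unitControls) (ht0 : t 0 = 0) (htn : t n = T)
    (hmono : ∀ i < n, t i ≤ t (i + 1)) (hmem : ∀ i ≤ n, t i ∈ Icc 0 T) :
    L ≤ |∫ s in (0 : ℝ)..T, g s * (freezeGap g L β s - β s)| ∨
      ∑ j ∈ Finset.range n, |∫ s in t j..t (j + 1), g s| - n * L ≤
        min (∫ s in (0 : ℝ)..T, (max (g s) 0 * freezeGap g L β s + max (-g s) 0 * β s))
          (∫ s in (0 : ℝ)..T, (max (-g s) 0 * freezeGap g L β s + max (g s) 0 * β s)) := by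
  by_cases h : ∃ s, 0 ≤ s ∧ s ≤ T ∧ L ≤ |gapAgainst g β s|
  · exact Or.inl (le_abs_integral_freezeGap hg hβ h)
  right
  have hT : 0 ≤ T := (hmem 0 (Nat.zero_le n)).1.trans (hmem 0 (Nat.zero_le n)).2
  have hone : ∀ s ∈ uIcc 0 T, freezeGap g L β s = 1 := by
    intro s hs
    rw [uIcc_of_le hT] at hs
    exact if_neg fun ⟨u, hu0, hus, hu⟩ => h ⟨u, hu0, hus.trans hs.2, hu⟩
  have hgap : ∀ i ≤ n, |gapAgainst g β (t i)| ≤ L := fun i hi =>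
    le_of_not_ge fun hL => h ⟨t i, (hmem i hi).1, (hmem i hi).2, hL⟩
  have hneg : ∀ s, gapAgainst (-g) β s = -gapAgainst g β s := fun s => by
    simp only [gapAgainst, Pi.neg_apply, neg_mul, intervalIntegral.integral_neg]
  refine le_min ?_ ?_
  · rw [intervalIntegral.integral_congr (g := fun s => max (g s) 0 * 1 + max (-g s) 0 * β s)
      fun s hs => by simp only [hone s hs], ← htn]
    exact variation_sub_le_integral hg hβ ht0 hmono hgap
  · rw [intervalIntegral.integral_congr (g := fun s => max (-g s) 0 * 1 + max (g s) 0 * β s)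
      fun s hs => by simp only [hone s hs], ← htn]
    have := variation_sub_le_integral hg.neg hβ ht0 hmono fun i hi => by
      rw [hneg, abs_neg]; exact hgap i hi
    simpa only [Pi.neg_apply, neg_neg, intervalIntegral.integral_neg, abs_neg] using this

/-- Game-theoretic form of the main theorem (lower bound (2.2)) for smooth
driving signals: the upper value `v = sup_{δ ∈ Δ} inf_{β ∈ 𝒰} J (δ β) β` of the
differential game dominates `min((1/n)·(∑_{j<n} |ξ(t_{j+1}) - ξ(t_j)| - R))₊, 1)`
for every partition of `[0,T]` with `n ≥ 1` intervals. -/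
theorem stmt6 (T R : ℝ) (hT : 0 < T) (hR : 0 < R) (ξ ξ' : ℝ → ℝ)
    (hderiv : ∀ t ∈ Set.Icc (0 : ℝ) T, HasDerivWithinAt ξ (ξ' t) (Set.Icc 0 T) t)
    (hcont : ContinuousOn ξ' (Set.Icc 0 T))
    (Θ : ℝ → ℝ → ℝ) (hΘ0 : ∀ a b, 0 ≤ Θ a b)
    (hΘ1 : ∀ a b, R ≤ min a b → 1 ≤ Θ a b)
    (𝒰 : Set (ℝ → ℝ))
    (h𝒰 : 𝒰 = {β | Measurable β ∧ ∀ s, β s ∈ Set.Icc (-1 : ℝ) 1})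
    (Δ : Set ((ℝ → ℝ) → (ℝ → ℝ)))
    (hΔ : Δ = {δ | (∀ β ∈ 𝒰, δ β ∈ 𝒰) ∧
      ∀ β ∈ 𝒰, ∀ β' ∈ 𝒰, ∀ t ∈ Set.Icc (0 : ℝ) T,
        (∀ᵐ s ∂(volume.restrict (Set.Icc 0 t)), β s = β' s) → δ β t = δ β' t})
    (X Y : (ℝ → ℝ) → (ℝ → ℝ) → ℝ)
    (hX : ∀ α β, X α β = ∫ s in (0 : ℝ)..T,
      (max (ξ' s) 0 * α s + max (-ξ' s) 0 * β s))
    (hY : ∀ α β, Y α β = ∫ s in (0 : ℝ)..T,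
      (max (-ξ' s) 0 * α s + max (ξ' s) 0 * β s))
    (J : (ℝ → ℝ) → (ℝ → ℝ) → ℝ)
    (hJ : ∀ α β, J α β = |X α β - Y α β| + Θ (X α β) (Y α β))
    (v : EReal)
    (hv : v = ⨆ δ ∈ Δ, ⨅ β ∈ 𝒰, ((J (δ β) β : ℝ) : EReal)) :
    ∀ (n : ℕ), 1 ≤ n → ∀ t : ℕ → ℝ, t 0 = 0 → t n = T →
      (∀ i < n, t i ≤ t (i + 1)) →
      v ≥ ((min (max ((1 / (n : ℝ)) *
        ((∑ j ∈ Finset.range n, |ξ (t (j + 1)) - ξ (t j)|) - R)) 0) 1 : ℝ) : EReal) := by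
  intro n hn t ht0 htn hmono
  change 𝒰 = unitControls at h𝒰
  subst h𝒰
  have hmem : ∀ i ≤ n, t i ∈ Icc 0 T := by
    have hm : Monotone fun i => t (min i n) := monotone_nat_of_le_succ fun i => by
      rcases lt_or_ge i n with h | h
      · simpa only [min_eq_left h.le, min_eq_left (Nat.succ_le_of_lt h)] using hmono i h
      · simp only [min_eq_right h, min_eq_right (h.trans (Nat.le_succ i)), le_refl]
    intro i hi
    constructor
    · simpa [hi, ht0] using hm (Nat.zero_le i)
    · simpa [hi, htn] using hm hi
  set g : ℝ → ℝ := IccExtend hT.le ((Icc 0 T).domRestrict ξ') with hg_def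
  have hg : Continuous g := hcont.domRestrict.Icc_extend'
  have hgξ : ∀ s ∈ Icc 0 T, g s = ξ' s := fun s hs => by
    rw [hg_def, IccExtend_of_mem hT.le _ hs, domRestrict_apply]
  have hftc : ∀ j < n, ∫ s in t j..t (j + 1), g s = ξ (t (j + 1)) - ξ (t j) := by
    intro j hj
    have hsub : Icc (t j) (t (j + 1)) ⊆ Icc 0 T :=
      Icc_subset_Icc (hmem j hj.le).1 (hmem (j + 1) hj).2
    refine intervalIntegral.integral_eq_sub_of_hasDerivAt_of_le (hmono j hj)
      (fun s hs => ((hderiv s (hsub hs)).continuousWithinAt).mono hsub) (fun s hs => ?_)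
      (hg.intervalIntegrable _ _)
    have hsT := hsub (Ioo_subset_Icc_self hs)
    rw [hgξ s hsT]
    exact (hderiv s hsT).hasDerivAt
      (mem_of_superset (Icc_mem_nhds hs.1 hs.2) hsub)
  have hvar : ∑ j ∈ Finset.range n, |∫ s in t j..t (j + 1), g s| =
      ∑ j ∈ Finset.range n, |ξ (t (j + 1)) - ξ (t j)| :=
    Finset.sum_congr rfl fun j hj => by rw [hftc j (Finset.mem_range.1 hj)]
  set V := ∑ j ∈ Finset.range n, |ξ (t (j + 1)) - ξ (t j)|
  set L := min (max ((1 / (n : ℝ)) * (V - R)) 0) 1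
  have hX' : ∀ α β, X α β = ∫ s in (0 : ℝ)..T, (max (g s) 0 * α s + max (-g s) 0 * β s) :=
    fun α β => (hX α β).trans <| intervalIntegral.integral_congr fun s hs => by
      rw [uIcc_of_le hT.le] at hs
      simp only [hgξ s hs]
  have hY' : ∀ α β, Y α β = ∫ s in (0 : ℝ)..T, (max (-g s) 0 * α s + max (g s) 0 * β s) :=
    fun α β => (hY α β).trans <| intervalIntegral.integral_congr fun s hs => by
      rw [uIcc_of_le hT.le] at hs
      simp only [hgξ s hs]
  have hXY : ∀ α ∈ unitControls, ∀ β ∈ unitControls,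
      X α β - Y α β = ∫ s in (0 : ℝ)..T, g s * (α s - β s) := by
    intro α hα β hβ
    have hp : ∀ γ ∈ unitControls,
        IntervalIntegrable (fun s => max (g s) 0 * γ s) volume 0 T := fun γ hγ =>
      intervalIntegrable_mul_of_mem_unitControls (hg.max continuous_const) hγ 0 T
    have hq : ∀ γ ∈ unitControls,
        IntervalIntegrable (fun s => max (-g s) 0 * γ s) volume 0 T := fun γ hγ =>
      intervalIntegrable_mul_of_mem_unitControls (hg.neg.max continuous_const) hγ 0 T
    rw [hX', hY', ← intervalIntegral.integral_sub ((hp α hα).add (hq β hβ))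
      ((hq α hα).add (hp β hβ))]
    refine intervalIntegral.integral_congr fun s _ => ?_
    have h : g s = max (g s) 0 - max (-g s) 0 := by
      rcases le_total 0 (g s) with h | h
      · rw [max_eq_left h, max_eq_right (by linarith)]; ring
      · rw [max_eq_right h, max_eq_left (by linarith)]; ring
    linear_combination -(α s - β s) * h
  have hδ : freezeGap g L ∈ Δ := by
    rw [hΔ]
    exact ⟨fun β _ => freezeGap_mem_unitControls g L β,
      fun β _ β' _ s hs h => freezeGap_congr g L hs.1 h⟩
  rw [hv, ge_iff_le]
  refine le_trans (le_iInf₂ fun β hβ => ?_)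
    (le_iSup₂ (f := fun δ (_ : δ ∈ Δ) =>
      ⨅ β ∈ unitControls, ((J (δ β) β : ℝ) : EReal)) (freezeGap g L) hδ)
  rw [EReal.coe_le_coe_iff, hJ]
  rcases freezeGap_dichotomy (L := L) hg hβ ht0 htn hmono hmem with h | h
  · rw [← hXY _ (freezeGap_mem_unitControls g L β) β hβ] at h
    linarith [hΘ0 (X (freezeGap g L β) β) (Y (freezeGap g L β) β)]
  · rw [hvar, ← hX', ← hY'] at h
    rcases le_total V R with hVR | hVR
    · have hL0 : L ≤ 0 := (min_le_left _ _).trans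
        (max_le (mul_nonpos_of_nonneg_of_nonpos (by positivity) (by linarith)) le_rfl)
      linarith [hΘ0 (X (freezeGap g L β) β) (Y (freezeGap g L β) β),
        abs_nonneg (X (freezeGap g L β) β - Y (freezeGap g L β) β)]
    · have hn0 : (0 : ℝ) < n := by exact_mod_cast hn
      have hL1 : L ≤ (1 / (n : ℝ)) * (V - R) := (min_le_left _ _).trans
        (max_le le_rfl (mul_nonneg (by positivity) (by linarith)))
      have hnL : n * L ≤ V - R := by
        calc n * L ≤ n * ((1 / (n : ℝ)) * (V - R)) := by gcongr
          _ = V - R := by field_simp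
      linarith [hΘ1 _ _ (le_trans (by linarith) h), min_le_right (max ((1 / (n : ℝ)) * (V - R)) 0) 1,
        abs_nonneg (X (freezeGap g L β) β - Y (freezeGap g L β) β)]
end

section
/- Let T > 0, R > 0, and let ξ : [0,T] → ℝ be continuously differentiable with total variation V_{0,T}(ξ) = ∫₀ᵀ |ξ'(s)| ds > R. Let Θ : ℝ² → ℝ be nonnegative with Θ(x,y) ≥ 1 whenever min{x, y} ≥ R. With 𝒰 the set of measurable controls β : [0,T] → [−1,1], Δ the set of progressive strategies δ : 𝒰 → 𝒰 (i.e. β = β' a.e. on [0,t] implies δ(β)(t) = δ(β')(t)), trajectories x^{α,β}(T) = ∫₀ᵀ (ξ'₊·α + ξ'₋·β), y^{α,β}(T) = ∫₀ᵀ (ξ'₋·α + ξ'₊·β), and payoff J(α,β) = |x^{α,β}(T) − y^{α,β}(T)| + Θ(x^{α,β}(T), y^{α,β}(T)), the upper game value v = sup_{δ ∈ Δ} inf_{β ∈ 𝒰} J(δ(β), β) is strictly positive. -/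
open MeasureTheory

/-- Measurable functions on the line with values in `[-1, 1]`. -/
def IsControl (β : ℝ → ℝ) : Prop :=
  Measurable β ∧ ∀ s, β s ∈ Set.Icc (-1 : ℝ) 1

lemma IsControl.intervalIntegrable {β : ℝ → ℝ} (hβ : IsControl β) (a b : ℝ) :
    IntervalIntegrable β volume a b := by
  refine (intervalIntegrable_const (c := (1 : ℝ))).mono_fun hβ.1.aestronglyMeasurable ?_
  filter_upwards with s
  simpa using abs_le.2 (hβ.2 s)

lemma IsControl.intervalIntegrable_mul {β f : ℝ → ℝ} (hβ : IsControl β) (hf : Continuous f)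
    (a b : ℝ) : IntervalIntegrable (fun s => f s * β s) volume a b :=
  (hβ.intervalIntegrable a b).continuousOn_mul hf.continuousOn

lemma IsControl.intervalIntegrable_mul_one_sub {β f : ℝ → ℝ} (hβ : IsControl β)
    (hf : Continuous f) (a b : ℝ) :
    IntervalIntegrable (fun s => f s * (1 - β s)) volume a b :=
  ((intervalIntegrable_const (c := (1 : ℝ))).sub
    (hβ.intervalIntegrable a b)).continuousOn_mul hf.continuousOn

lemma intervalIntegral_congr_of_ae_Icc {g h : ℝ → ℝ} {s t : ℝ} (hs : 0 ≤ s) (hst : s ≤ t)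
    (hgh : ∀ᵐ r ∂(volume.restrict (Set.Icc 0 t)), g r = h r) :
    ∫ r in (0 : ℝ)..s, g r = ∫ r in (0 : ℝ)..s, h r := by
  rw [intervalIntegral.integral_of_le hs, intervalIntegral.integral_of_le hs]
  refine integral_congr_ae (ae_mono (Measure.restrict_mono ?_ le_rfl) hgh)
  exact fun r hr => ⟨hr.1.le, hr.2.trans hst⟩

/-- A representative of `β` whose value at `t` is read off from the left difference quotients at
`t` of the primitive of `β`, and hence only depends on `β` almost everywhere on `[0, t]`. -/
noncomputable def leftRep (β : ℝ → ℝ) (t : ℝ) : ℝ :=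
  max (-1) (min 1 (Filter.limsup (fun n : ℕ => ((n : ℝ) + 1) *
    ((∫ r in (0 : ℝ)..t, β r) - ∫ r in (0 : ℝ)..(max (t - 1 / ((n : ℝ) + 1)) 0), β r))
    Filter.atTop))

lemma IsControl.leftRep {β : ℝ → ℝ} (hβ : IsControl β) : IsControl (leftRep β) := by
  have hc := intervalIntegral.continuous_primitive hβ.intervalIntegrable 0
  refine ⟨?_, fun s => ⟨le_max_left _ _, max_le (by norm_num) (min_le_left _ _)⟩⟩
  refine measurable_const.max (measurable_const.min (Measurable.limsup fun n => ?_))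
  refine Continuous.measurable ?_
  have : Continuous fun t : ℝ =>
      ∫ r in (0 : ℝ)..(max (t - 1 / ((n : ℝ) + 1)) 0), β r :=
    hc.comp (by fun_prop)
  exact continuous_const.mul (hc.sub this)

lemma leftRep_congr {β β' : ℝ → ℝ} {t : ℝ} (ht : 0 ≤ t)
    (h : ∀ᵐ s ∂(volume.restrict (Set.Icc 0 t)), β s = β' s) : leftRep β t = leftRep β' t := by
  have key : ∀ n : ℕ, ∫ r in (0 : ℝ)..(max (t - 1 / ((n : ℝ) + 1)) 0), β r =
      ∫ r in (0 : ℝ)..(max (t - 1 / ((n : ℝ) + 1)) 0), β' r := fun n =>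
    intervalIntegral_congr_of_ae_Icc (le_max_right _ _)
      (max_le (sub_le_self _ (by positivity)) ht) h
  simp only [leftRep, key, intervalIntegral_congr_of_ae_Icc ht le_rfl h]

lemma IsControl.leftRep_ae_eq {β : ℝ → ℝ} (hβ : IsControl β) :
    ∀ᵐ t, 0 < t → _root_.leftRep β t = β t := by
  have hloc : LocallyIntegrable β volume := by
    refine (locallyIntegrable_const (1 : ℝ)).mono hβ.1.aestronglyMeasurable ?_
    filter_upwards with s
    simpa using abs_le.2 (hβ.2 s)
  filter_upwards [LocallyIntegrable.ae_hasDerivAt_integral hloc] with t ht ht0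
  have hseq : Filter.Tendsto (fun n : ℕ => -(1 / ((n : ℝ) + 1))) Filter.atTop
      (nhdsWithin 0 (Set.Iio 0)) := by
    refine tendsto_nhdsWithin_iff.2 ⟨?_, ?_⟩
    · simpa using (tendsto_one_div_add_atTop_nhds_zero_nat (𝕜 := ℝ)).neg
    · filter_upwards with n
      have : 0 < 1 / ((n : ℝ) + 1) := by positivity
      simpa using this
  have hlim := (ht 0).tendsto_slope_zero_left.comp hseq
  have hev : ∀ᶠ n : ℕ in Filter.atTop, 1 / ((n : ℝ) + 1) < t :=
    (tendsto_one_div_add_atTop_nhds_zero_nat (𝕜 := ℝ)).eventually_lt_const ht0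
  have hlim' : Filter.Tendsto (fun n : ℕ => ((n : ℝ) + 1) *
      ((∫ r in (0 : ℝ)..t, β r) - ∫ r in (0 : ℝ)..(max (t - 1 / ((n : ℝ) + 1)) 0), β r))
      Filter.atTop (nhds (β t)) := by
    refine hlim.congr' ?_
    filter_upwards [hev] with n hn
    rw [max_eq_left (by linarith)]
    simp only [Function.comp_apply, smul_eq_mul, ← sub_eq_add_neg, inv_neg, one_div, inv_inv]
    ring
  rw [_root_.leftRep, hlim'.limsup_eq, min_eq_right (hβ.2 t).2, max_eq_right (hβ.2 t).1]

/-- If all the primitives of `f * (1 - β)` are small, then so is the integral of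
`|f| * (1 - β)`, uniformly in the control `β`. -/
lemma exists_integral_abs_mul_one_sub_le {T η : ℝ} (hT : 0 < T) (hη : 0 < η) {f : ℝ → ℝ}
    (hf : Continuous f) :
    ∃ ε > 0, ∀ β, IsControl β →
      (∀ t ∈ Set.Icc (0 : ℝ) T, |∫ s in (0 : ℝ)..t, f s * (1 - β s)| < ε) →
      ∫ s in (0 : ℝ)..T, |f s| * (1 - β s) ≤ η := by
  have huc : UniformContinuousOn f (Set.Icc 0 T) :=
    isCompact_Icc.uniformContinuousOn_of_continuous hf.continuousOn
  obtain ⟨d, hd, hfd⟩ := Metric.uniformContinuousOn_iff.1 huc (η / (8 * T)) (by positivity)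
  obtain ⟨n, hn⟩ := exists_nat_gt (T / d)
  have hn0 : (0 : ℝ) < n := lt_trans (by positivity) hn
  have hstep : T / n < d := by
    rw [div_lt_iff₀ hn0]
    rwa [div_lt_iff₀ hd, mul_comm] at hn
  refine ⟨η / (4 * n), by positivity, fun β hβ hsmall => ?_⟩
  set a : ℕ → ℝ := fun k => k * (T / n) with ha
  have ha_succ : ∀ k, a (k + 1) = a k + T / n := fun k => by simp only [ha]; push_cast; ring
  have ha_zero : a 0 = 0 := by simp [ha]
  have ha_last : a n = T := by simp only [ha]; field_simp
  have hTn : 0 < T / n := by positivity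
  have ha_mem : ∀ k ≤ n, a k ∈ Set.Icc (0 : ℝ) T := fun k hk => by
    refine ⟨by positivity, ?_⟩
    rw [← ha_last]
    have : (k : ℝ) ≤ n := by exact_mod_cast hk
    simp only [ha]
    gcongr
  have hpiece : ∀ k ∈ Finset.range n,
      ∫ s in (a k)..(a (k + 1)), |f s| * (1 - β s) ≤ η / n := by
    intro k hk
    have hk := Finset.mem_range.1 hk
    have hle : a k ≤ a (k + 1) := by rw [ha_succ]; linarith
    have hmem := ha_mem k hk.le
    have hmem' := ha_mem (k + 1) hk
    obtain ⟨σ, hσ, hσf⟩ : ∃ σ : ℝ, |σ| = 1 ∧ σ * f (a k) = |f (a k)| := by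
      rcases le_total 0 (f (a k)) with h | h
      · exact ⟨1, by simp, by rw [abs_of_nonneg h, one_mul]⟩
      · exact ⟨-1, by simp, by rw [abs_of_nonpos h]; ring⟩
    have hpt : ∀ s ∈ Set.Icc (a k) (a (k + 1)),
        |f s| * (1 - β s) ≤ σ * (f s * (1 - β s)) + η / (2 * T) := by
      intro s hs
      have hclose : |f s - f (a k)| < η / (8 * T) := by
        refine hfd s ⟨hmem.1.trans hs.1, hs.2.trans hmem'.2⟩ (a k) hmem ?_
        rw [Real.dist_eq, abs_of_nonneg (sub_nonneg.2 hs.1)]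
        have := hs.2
        rw [ha_succ] at this
        linarith
      have h1 : |f s| ≤ |f (a k)| + |f s - f (a k)| := by
        have := abs_sub_abs_le_abs_sub (f s) (f (a k))
        linarith
      have h2 : |σ * (f s - f (a k))| = |f s - f (a k)| := by rw [abs_mul, hσ, one_mul]
      have h3 := neg_abs_le (σ * (f s - f (a k)))
      have h4 : |f s| - σ * f s ≤ 2 * (η / (8 * T)) := by
        rw [h2, mul_sub, hσf] at h3
        linarith
      obtain ⟨hβ1, hβ2⟩ := hβ.2 s
      have hc : 0 < η / (8 * T) := by positivity
      have h5 : η / (2 * T) = 2 * (η / (8 * T)) * 2 := by field_simp; ring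
      have h6 : (|f s| - σ * f s) * (1 - β s) ≤ 2 * (η / (8 * T)) * (1 - β s) :=
        mul_le_mul_of_nonneg_right h4 (by linarith)
      have h7 : 2 * (η / (8 * T)) * (1 - β s) ≤ 2 * (η / (8 * T)) * 2 :=
        mul_le_mul_of_nonneg_left (by linarith) (by positivity)
      rw [h5]
      linarith
    have hint := hβ.intervalIntegrable_mul_one_sub hf
    have hmono := intervalIntegral.integral_mono_on hle
      (hβ.intervalIntegrable_mul_one_sub hf.abs _ _)
      (((hint _ _).const_mul σ).add intervalIntegrable_const) hpt
    rw [intervalIntegral.integral_add ((hint _ _).const_mul σ) intervalIntegrable_const,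
      intervalIntegral.integral_const_mul, intervalIntegral.integral_const,
      ← intervalIntegral.integral_interval_sub_left (hint 0 _) (hint 0 _), ha_succ] at hmono
    rw [ha_succ] at hmem' ⊢
    have hs1 := abs_lt.1 (hsmall _ hmem)
    have hs2 := abs_lt.1 (hsmall _ hmem')
    have h8 : ∀ w : ℝ, σ * w ≤ |w| := fun w => by
      calc σ * w ≤ |σ * w| := le_abs_self _
        _ = |w| := by rw [abs_mul, hσ, one_mul]
    have h9 : |(∫ s in (0 : ℝ)..(a k + T / n), f s * (1 - β s)) -
        ∫ s in (0 : ℝ)..(a k), f s * (1 - β s)| ≤ 2 * (η / (4 * n)) :=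
      abs_le.2 ⟨by linarith, by linarith⟩
    have h10 : (a k + T / n - a k) • (η / (2 * T)) = η / (2 * n) := by
      rw [smul_eq_mul]; field_simp; ring
    rw [h10] at hmono
    have h11 : η / n = 2 * (η / (4 * n)) + η / (2 * n) := by field_simp; ring
    rw [h11]
    exact hmono.trans (add_le_add_left ((h8 _).trans h9) _)
  calc ∫ s in (0 : ℝ)..T, |f s| * (1 - β s)
      = ∑ k ∈ Finset.range n, ∫ s in (a k)..(a (k + 1)), |f s| * (1 - β s) := by
        rw [intervalIntegral.sum_integral_adjacent_intervals fun k _ =>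
          hβ.intervalIntegrable_mul_one_sub hf.abs _ _, ha_zero, ha_last]
    _ ≤ ∑ _k ∈ Finset.range n, η / n := Finset.sum_le_sum hpiece
    _ = η := by simp; field_simp

/-- The strategy that plays `1` until the gap `∫₀ᵗ f (1 - β)` has reached size `ε`, and copies the
opponent afterwards, which freezes the gap. -/
noncomputable def gapStrategy (f : ℝ → ℝ) (ε : ℝ) (β : ℝ → ℝ) (t : ℝ) : ℝ :=
  open Classical in
  if ∃ s ∈ Set.Icc 0 t, ε ≤ |∫ r in (0 : ℝ)..s, f r * (1 - β r)| then leftRep β t else 1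

lemma IsControl.gapStrategy {β : ℝ → ℝ} (hβ : IsControl β) (f : ℝ → ℝ) (ε : ℝ) :
    IsControl (gapStrategy f ε β) := by
  have hmeas : MeasurableSet
      {t : ℝ | ∃ s ∈ Set.Icc 0 t, ε ≤ |∫ r in (0 : ℝ)..s, f r * (1 - β r)|} := by
    refine Set.OrdConnected.measurableSet (IsUpperSet.ordConnected ?_)
    rintro t t' htt' ⟨s, hs, hε⟩
    exact ⟨s, ⟨hs.1, hs.2.trans htt'⟩, hε⟩
  refine ⟨Measurable.ite hmeas hβ.leftRep.1 measurable_const, fun s => ?_⟩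
  unfold _root_.gapStrategy
  split_ifs
  · exact hβ.leftRep.2 s
  · norm_num

lemma gapStrategy_congr (f : ℝ → ℝ) (ε : ℝ) {β β' : ℝ → ℝ} {t : ℝ} (ht : 0 ≤ t)
    (h : ∀ᵐ s ∂(volume.restrict (Set.Icc 0 t)), β s = β' s) :
    gapStrategy f ε β t = gapStrategy f ε β' t := by
  have hgap : ∀ s ∈ Set.Icc 0 t, ∫ r in (0 : ℝ)..s, f r * (1 - β r) =
      ∫ r in (0 : ℝ)..s, f r * (1 - β' r) := fun s hs =>
    intervalIntegral_congr_of_ae_Icc hs.1 hs.2 (h.mono fun r hr => by rw [hr])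
  have hiff : (∃ s ∈ Set.Icc 0 t, ε ≤ |∫ r in (0 : ℝ)..s, f r * (1 - β r)|) ↔
      ∃ s ∈ Set.Icc 0 t, ε ≤ |∫ r in (0 : ℝ)..s, f r * (1 - β' r)| :=
    exists_congr fun s => and_congr_right fun hs => by rw [hgap s hs]
  unfold gapStrategy
  classical exact if_congr hiff (leftRep_congr ht h) rfl

/-- Once the gap has reached size `ε`, it keeps that size until the end. -/
lemma le_abs_integral_gapStrategy {f β : ℝ → ℝ} {T ε : ℝ} (hf : Continuous f)
    (hβ : IsControl β)
    (hit : ∃ t ∈ Set.Icc (0 : ℝ) T, ε ≤ |∫ s in (0 : ℝ)..t, f s * (1 - β s)|) :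
    ε ≤ |∫ s in (0 : ℝ)..T, f s * (gapStrategy f ε β s - β s)| := by
  have hcont : Continuous fun t : ℝ => |∫ s in (0 : ℝ)..t, f s * (1 - β s)| :=
    (intervalIntegral.continuous_primitive (hβ.intervalIntegrable_mul_one_sub hf) 0).abs
  have hcomp : IsCompact (Set.Icc (0 : ℝ) T ∩
      {t | ε ≤ |∫ s in (0 : ℝ)..t, f s * (1 - β s)|}) :=
    isCompact_Icc.inter_right (isClosed_le continuous_const hcont)
  obtain ⟨τ, ⟨⟨hτ, hτε⟩, hmin⟩⟩ := hcomp.exists_isLeast hit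
  have hint : ∀ a b, IntervalIntegrable (fun s => f s * (gapStrategy f ε β s - β s))
      volume a b := fun a b =>
    (((hβ.gapStrategy f ε).intervalIntegrable a b).sub
      (hβ.intervalIntegrable a b)).continuousOn_mul hf.continuousOn
  have hbefore : ∫ s in (0 : ℝ)..τ, f s * (gapStrategy f ε β s - β s) =
      ∫ s in (0 : ℝ)..τ, f s * (1 - β s) := by
    refine intervalIntegral.integral_congr_ae ?_
    filter_upwards [Measure.ae_ne volume τ] with s hsτ hs
    rw [Set.uIoc_of_le hτ.1] at hs
    have hno : ¬ ∃ r ∈ Set.Icc 0 s, ε ≤ |∫ q in (0 : ℝ)..r, f q * (1 - β q)| := by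
      rintro ⟨r, hr, hrε⟩
      have := hmin ⟨⟨hr.1, (hr.2.trans hs.2).trans hτ.2⟩, hrε⟩
      exact hsτ (le_antisymm hs.2 (this.trans hr.2))
    simp only [gapStrategy, if_neg hno]
  have hafter : ∫ s in τ..T, f s * (gapStrategy f ε β s - β s) = 0 := by
    refine intervalIntegral.integral_zero_ae ?_
    filter_upwards [hβ.leftRep_ae_eq] with s hs hsτ
    rw [Set.uIoc_of_le hτ.2] at hsτ
    have hyes : ∃ r ∈ Set.Icc 0 s, ε ≤ |∫ q in (0 : ℝ)..r, f q * (1 - β q)| :=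
      ⟨τ, ⟨hτ.1, hsτ.1.le⟩, hτε⟩
    simp only [gapStrategy, if_pos hyes, hs (hτ.1.trans_lt hsτ.1), sub_self, mul_zero]
  rw [← intervalIntegral.integral_add_adjacent_intervals (hint 0 τ) (hint τ T), hbefore, hafter,
    add_zero]
  exact hτε

/-- A coordinate driven by `|f| - g` at speed `1` and by `g ≤ |f|` at speed `β` falls short of
`∫ |f|` by at most `∫ |f| (1 - β)`. -/
lemma integral_abs_sub_le {f g β : ℝ → ℝ} {T : ℝ} (hT : 0 ≤ T) (hf : Continuous f)
    (hg : Continuous g) (hgf : ∀ s, g s ≤ |f s|) (hβ : IsControl β) :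
    (∫ s in (0 : ℝ)..T, |f s|) - ∫ s in (0 : ℝ)..T, |f s| * (1 - β s) ≤
      ∫ s in (0 : ℝ)..T, ((|f s| - g s) * 1 + g s * β s) := by
  have hi := hβ.intervalIntegrable_mul_one_sub hf.abs 0 T
  have hf' := hf.abs.intervalIntegrable (μ := volume) 0 T
  rw [← intervalIntegral.integral_sub hf' hi]
  refine intervalIntegral.integral_mono_on hT (hf'.sub hi) ?_ fun s _ => ?_
  · exact ((hf.abs.sub hg).mul continuous_const |>.intervalIntegrable 0 T).add
      (hβ.intervalIntegrable_mul hg 0 T)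
  · have := mul_le_mul_of_nonneg_right (hgf s) (sub_nonneg.2 (hβ.2 s).2)
    linarith

/-- Final claim of the main theorem in game-theoretic form: if the total
variation `∫₀ᵀ |ξ'|` of the smooth driving signal exceeds `R`, then the upper
value of the differential game is strictly positive. -/
theorem stmt7 (T R : ℝ) (hT : 0 < T) (hR : 0 < R) (ξ ξ' : ℝ → ℝ)
    (hderiv : ∀ t ∈ Set.Icc (0 : ℝ) T, HasDerivWithinAt ξ (ξ' t) (Set.Icc 0 T) t)
    (hcont : ContinuousOn ξ' (Set.Icc 0 T))
    (hvar : R < ∫ s in (0 : ℝ)..T, |ξ' s|)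
    (Θ : ℝ → ℝ → ℝ) (hΘ0 : ∀ a b, 0 ≤ Θ a b)
    (hΘ1 : ∀ a b, R ≤ min a b → 1 ≤ Θ a b)
    (𝒰 : Set (ℝ → ℝ))
    (h𝒰 : 𝒰 = {β | Measurable β ∧ ∀ s, β s ∈ Set.Icc (-1 : ℝ) 1})
    (Δ : Set ((ℝ → ℝ) → (ℝ → ℝ)))
    (hΔ : Δ = {δ | (∀ β ∈ 𝒰, δ β ∈ 𝒰) ∧
      ∀ β ∈ 𝒰, ∀ β' ∈ 𝒰, ∀ t ∈ Set.Icc (0 : ℝ) T,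
        (∀ᵐ s ∂(volume.restrict (Set.Icc 0 t)), β s = β' s) → δ β t = δ β' t})
    (X Y : (ℝ → ℝ) → (ℝ → ℝ) → ℝ)
    (hX : ∀ α β, X α β = ∫ s in (0 : ℝ)..T,
      (max (ξ' s) 0 * α s + max (-ξ' s) 0 * β s))
    (hY : ∀ α β, Y α β = ∫ s in (0 : ℝ)..T,
      (max (-ξ' s) 0 * α s + max (ξ' s) 0 * β s))
    (J : (ℝ → ℝ) → (ℝ → ℝ) → ℝ)
    (hJ : ∀ α β, J α β = |X α β - Y α β| + Θ (X α β) (Y α β))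
    (v : EReal)
    (hv : v = ⨆ δ ∈ Δ, ⨅ β ∈ 𝒰, ((J (δ β) β : ℝ) : EReal)) :
    0 < v := by
  obtain ⟨f, hf, hfξ⟩ : ∃ f : ℝ → ℝ, Continuous f ∧ ∀ s ∈ Set.Icc (0 : ℝ) T, ξ' s = f s :=
    ⟨Set.IccExtend hT.le ((Set.Icc 0 T).domRestrict ξ'), hcont.domRestrict.Icc_extend',
      fun s hs => by rw [Set.IccExtend_of_mem _ _ hs]; rfl⟩
  have hsub : ∀ s ∈ Set.uIcc (0 : ℝ) T, ξ' s = f s := fun s hs =>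
    hfξ s (by rwa [Set.uIcc_of_le hT.le] at hs)
  have hX' : ∀ α β, X α β = ∫ s in (0 : ℝ)..T, (max (f s) 0 * α s + max (-f s) 0 * β s) :=
    fun α β => (hX α β).trans
      (intervalIntegral.integral_congr fun s hs => by simp only [hsub s hs])
  have hY' : ∀ α β, Y α β = ∫ s in (0 : ℝ)..T, (max (-f s) 0 * α s + max (f s) 0 * β s) :=
    fun α β => (hY α β).trans
      (intervalIntegral.integral_congr fun s hs => by simp only [hsub s hs])
  have hvar' : R < ∫ s in (0 : ℝ)..T, |f s| :=
    hvar.trans_eq (intervalIntegral.integral_congr fun s hs => by simp only [hsub s hs])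
  have hpos : Continuous fun s => max (f s) 0 := hf.max continuous_const
  have hneg : Continuous fun s => max (-f s) 0 := hf.neg.max continuous_const
  have habs : ∀ s, |f s| = max (f s) 0 + max (-f s) 0 := fun s =>
    (posPart_add_negPart (f s)).symm
  have hdiff : ∀ s, f s = max (f s) 0 - max (-f s) 0 := fun s =>
    (posPart_sub_negPart (f s)).symm
  have hXY : ∀ α β, IsControl α → IsControl β →
      X α β - Y α β = ∫ s in (0 : ℝ)..T, f s * (α s - β s) := by
    intro α β hα hβ
    rw [hX', hY', ← intervalIntegral.integral_sub
      ((hα.intervalIntegrable_mul hpos 0 T).add (hβ.intervalIntegrable_mul hneg 0 T))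
      ((hα.intervalIntegrable_mul hneg 0 T).add (hβ.intervalIntegrable_mul hpos 0 T))]
    refine intervalIntegral.integral_congr fun s _ => ?_
    linear_combination (β s - α s) * hdiff s
  obtain ⟨ε, hε, hsmall⟩ := exists_integral_abs_mul_one_sub_le hT (sub_pos.2 hvar') hf
  have hstrat : gapStrategy f ε ∈ Δ := by
    subst h𝒰 hΔ
    exact ⟨fun β hβ => IsControl.gapStrategy hβ f ε,
      fun β _ β' _ t ht h => gapStrategy_congr f ε ht.1 h⟩
  have hpay : ∀ β ∈ 𝒰, min ε 1 ≤ J (gapStrategy f ε β) β := by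
    intro β hβ
    have hβ : IsControl β := by subst h𝒰; exact hβ
    rw [hJ]
    by_cases hit : ∃ t ∈ Set.Icc (0 : ℝ) T, ε ≤ |∫ s in (0 : ℝ)..t, f s * (1 - β s)|
    · rw [hXY _ _ (hβ.gapStrategy f ε) hβ]
      have h1 := le_abs_integral_gapStrategy hf hβ hit
      exact (min_le_left _ _).trans (h1.trans (le_add_of_nonneg_right (hΘ0 _ _)))
    · have hone : ∀ s ∈ Set.uIcc (0 : ℝ) T, gapStrategy f ε β s = 1 := by
        intro s hs
        rw [Set.uIcc_of_le hT.le] at hs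
        exact if_neg fun ⟨r, hr, hrε⟩ => hit ⟨r, ⟨hr.1, hr.2.trans hs.2⟩, hrε⟩
      push Not at hit
      have hη := hsmall β hβ hit
      have hXR : R ≤ X (gapStrategy f ε β) β := by
        have h1 := integral_abs_sub_le hT.le hf hneg
          (fun s => by rw [habs]; exact le_add_of_nonneg_left (le_max_right _ _)) hβ
        have h2 : X (gapStrategy f ε β) β =
            ∫ s in (0 : ℝ)..T, ((|f s| - max (-f s) 0) * 1 + max (-f s) 0 * β s) := by
          rw [hX']
          refine intervalIntegral.integral_congr fun s hs => ?_
          simp only [hone s hs, habs, add_sub_cancel_right]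
        linarith
      have hYR : R ≤ Y (gapStrategy f ε β) β := by
        have h1 := integral_abs_sub_le hT.le hf hpos 
          (fun s => by rw [habs]; exact le_add_of_nonneg_right (le_max_right _ _)) hβ
        have h2 : Y (gapStrategy f ε β) β =
            ∫ s in (0 : ℝ)..T, ((|f s| - max (f s) 0) * 1 + max (f s) 0 * β s) := by
          rw [hY']
          refine intervalIntegral.integral_congr fun s hs => ?_
          simp only [hone s hs, habs, add_sub_cancel_left]
        linarith
      exact (min_le_right _ _).trans
        ((hΘ1 _ _ (le_min hXR hYR)).trans (le_add_of_nonneg_left (abs_nonneg _)))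
  have hval : ((min ε 1 : ℝ) : EReal) ≤ v := by
    rw [hv]
    refine le_iSup₂_of_le (gapStrategy f ε) hstrat (le_iInf₂ fun β hβ => ?_)
    exact EReal.coe_le_coe_iff.2 (hpay β hβ)
  exact (EReal.coe_pos.2 (lt_min hε one_pos)).trans_le hval
end
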